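/- arXiv:1404.7068 — 2 statements merged into one kernel-verified Lean document; each statement's English description precedes it below -/
import Mathlib

section
/- Let (P, d, μ) be a metric measure space where μ is a σ-finite Borel regular measure such that every open ball has finite positive measure, and μ is doubling: there is a constant C_d ≥ 1 with μ(B(x,2r)) ≤ C_d μ(B(x,r)) for all x ∈ P, r > 0. Then there is a constant C > 0, depending only on the doubling constant, such that for every μ-measurable u and every t ∈ (0, μ(P)): u**(t) ≤ C · (M₁u)*(t), where M₁ is the non-centered Hardy–Littlewood maximal operator. -/
open MeasureTheory
open scoped ENNReal NNReal

/-- The non-centered Hardy–Littlewood-type maximal operator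
`M_p u (x) = sup_{B ∋ x} ((1/μ B) ∫_B u^p dμ)^{1/p}`, the supremum being taken over
open balls containing `x`. -/
noncomputable def maximalFn {P : Type*} [PseudoMetricSpace P] [MeasurableSpace P]
    (μ : Measure P) (p : ℝ) (u : P → ℝ≥0∞) (x : P) : ℝ≥0∞ :=
  ⨆ (c : P) (r : ℝ) (_ : 0 < r) (_ : x ∈ Metric.ball c r),
    ((μ (Metric.ball c r))⁻¹ * ∫⁻ z in Metric.ball c r, u z ^ p ∂μ) ^ (1 / p)

/-- The decreasing rearrangement `u*(t) = inf {s : μ {|u| > s} ≤ t}` of `u` (given here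
for the modulus `u : P → [0,∞]` of a measurable function). -/
noncomputable def rearr {P : Type*} [MeasurableSpace P] (μ : Measure P)
    (u : P → ℝ≥0∞) (t : ℝ) : ℝ≥0∞ :=
  sInf {s : ℝ≥0∞ | μ {x | s < u x} ≤ ENNReal.ofReal t}

/-- The elementary maximal function `u**(t) = (1/t) ∫₀^t u*(s) ds`. -/
noncomputable def doubleStar {P : Type*} [MeasurableSpace P] (μ : Measure P)
    (u : P → ℝ≥0∞) (t : ℝ) : ℝ≥0∞ :=
  (ENNReal.ofReal t)⁻¹ * ∫⁻ s in Set.Ioo (0 : ℝ) t, rearr μ u s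

open Set Filter Metric Topology

section LayerCake

theorem volume_restrict_Ioi_ofReal_lt (a : ℝ≥0∞) :
    (volume.restrict (Ioi (0 : ℝ))) {σ | ENNReal.ofReal σ < a} = a := by
  rw [Measure.restrict_apply (measurableSet_lt (by fun_prop) measurable_const)]
  induction a with
  | top => simp
  | coe a =>
    have : {σ : ℝ | ENNReal.ofReal σ < a} ∩ Ioi 0 = Ioo 0 (a : ℝ) := by
      ext σ
      simp only [mem_inter_iff, mem_ofPred_eq, mem_Ioi, mem_Ioo]
      constructor
      · rintro ⟨h, h0⟩
        refine ⟨h0, ?_⟩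
        rwa [← ENNReal.ofReal_coe_nnreal, ENNReal.ofReal_lt_ofReal_iff_of_nonneg h0.le] at h
      · rintro ⟨h0, h⟩
        refine ⟨?_, h0⟩
        rwa [← ENNReal.ofReal_coe_nnreal, ENNReal.ofReal_lt_ofReal_iff_of_nonneg h0.le]
    rw [this, Real.volume_Ioo]
    simp

theorem lintegral_eq_lintegral_Ioi_measure_ofReal_lt {α : Type*} [MeasurableSpace α]
    (μ : Measure α) [SFinite μ] {f : α → ℝ≥0∞} (hf : Measurable f) :
    ∫⁻ x, f x ∂μ = ∫⁻ σ in Ioi (0 : ℝ), μ {x | ENNReal.ofReal σ < f x} := by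
  have hS : MeasurableSet {p : α × ℝ | ENNReal.ofReal p.2 < f p.1} :=
    measurableSet_lt (by fun_prop) (by fun_prop)
  have h := Measure.prod_apply (μ := μ) (ν := volume.restrict (Ioi (0 : ℝ))) hS
  rw [Measure.prod_apply_symm hS] at h
  simp only [preimage_ofPred_eq] at h
  rw [h]
  exact lintegral_congr fun x => (volume_restrict_Ioi_ofReal_lt (f x)).symm

end LayerCake

section Rearrangement

variable {P : Type*} [MeasurableSpace P] (μ : Measure P)

theorem rearr_antitone (u : P → ℝ≥0∞) : Antitone (rearr μ u) := fun _ _ hst =>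
  sInf_le_sInf fun _ h => le_trans h (ENNReal.ofReal_le_ofReal hst)

theorem ofReal_lt_measure_of_lt_rearr {u : P → ℝ≥0∞} {s : ℝ} {σ : ℝ≥0∞} (h : σ < rearr μ u s) :
    ENNReal.ofReal s < μ {x | σ < u x} := by
  by_contra! h'
  exact absurd (sInf_le (show σ ∈ {σ | μ {x | σ < u x} ≤ ENNReal.ofReal s} from h')) (not_le.2 h)

theorem lintegral_rearr_le [SFinite μ] {u : P → ℝ≥0∞} (hu : Measurable u) :
    ∫⁻ s in Ioi (0 : ℝ), rearr μ u s ≤ ∫⁻ x, u x ∂μ := by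
  rw [lintegral_eq_lintegral_Ioi_measure_ofReal_lt _ (rearr_antitone μ u).measurable,
    lintegral_eq_lintegral_Ioi_measure_ofReal_lt μ hu]
  refine lintegral_mono fun σ => ?_
  refine (measure_mono fun s hs => ofReal_lt_measure_of_lt_rearr μ hs).trans ?_
  exact (volume_restrict_Ioi_ofReal_lt _).le

theorem rearr_le_add_of_ae_le_add {u v : P → ℝ≥0∞} {a : ℝ≥0∞} (h : ∀ᵐ x ∂μ, u x ≤ a + v x)
    (s : ℝ) : rearr μ u s ≤ a + rearr μ v s := by
  unfold rearr
  rw [ENNReal.add_sInf]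
  refine le_iInf₂ fun σ hσ => sInf_le ?_
  refine le_trans (measure_mono_ae ?_) hσ
  filter_upwards [h] with x hx (hlt : a + σ < u x)
  exact lt_of_add_lt_add_left (hlt.trans_le hx)

theorem doubleStar_le_of_ae_le_add [SFinite μ] {u v : P → ℝ≥0∞} (hv : Measurable v)
    {a b : ℝ≥0∞} (h : ∀ᵐ x ∂μ, u x ≤ a + v x) {t : ℝ} (ht : 0 < t)
    (hb : ∫⁻ x, v x ∂μ ≤ b * ENNReal.ofReal t) : doubleStar μ u t ≤ a + b := by
  have h0 : ENNReal.ofReal t ≠ 0 := by simpa using ht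
  unfold doubleStar
  rw [mul_comm, ← div_eq_mul_inv]
  refine ENNReal.div_le_of_le_mul ?_
  calc ∫⁻ s in Ioo 0 t, rearr μ u s
      ≤ ∫⁻ s in Ioo 0 t, (a + rearr μ v s) :=
        lintegral_mono fun s => rearr_le_add_of_ae_le_add μ h s
    _ = a * ENNReal.ofReal t + ∫⁻ s in Ioo 0 t, rearr μ v s := by
        rw [lintegral_add_left measurable_const]
        simp
    _ ≤ a * ENNReal.ofReal t + ∫⁻ s in Ioi 0, rearr μ v s := by
        gcongr
        exact Ioo_subset_Ioi_self
    _ ≤ (a + b) * ENNReal.ofReal t := by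
        rw [add_mul]
        gcongr
        exact (lintegral_rearr_le μ hv).trans hb

end Rearrangement

section MaximalFunction

variable {P : Type*} [PseudoMetricSpace P] [MeasurableSpace P] (μ : Measure P)

theorem isOpen_lt_maximalFn (p : ℝ) (u : P → ℝ≥0∞) (s : ℝ≥0∞) :
    IsOpen {x | s < maximalFn μ p u x} := by
  rw [isOpen_iff_forall_mem_open]
  intro x (hx : s < maximalFn μ p u x)
  simp only [maximalFn, lt_iSup_iff] at hx
  obtain ⟨c, r, hr, hxc, h⟩ := hx
  refine ⟨ball c r, fun y hy => ?_, isOpen_ball, hxc⟩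
  simp only [mem_ofPred_eq, maximalFn, lt_iSup_iff]
  exact ⟨c, r, hr, hy, h⟩

theorem setLIntegral_ball_le_of_maximalFn_le {u : P → ℝ≥0∞} {s : ℝ≥0∞} {x c : P} {r : ℝ}
    (hx : maximalFn μ 1 u x ≤ s) (hxc : x ∈ ball c r) (h0 : μ (ball c r) ≠ 0)
    (ht : μ (ball c r) ≠ ⊤) : ∫⁻ z in ball c r, u z ∂μ ≤ s * μ (ball c r) := by
  have hr : 0 < r := pos_of_mem_ball hxc
  have h : (μ (ball c r))⁻¹ * ∫⁻ z in ball c r, u z ∂μ ≤ s := by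
    refine le_trans ?_ hx
    simp only [maximalFn]
    refine le_iSup₂_of_le c r (le_iSup₂_of_le hr hxc ?_)
    simp
  rw [mul_comm, ← div_eq_mul_inv] at h
  exact (ENNReal.div_le_iff h0 ht).1 h

theorem setLIntegral_closedBall_le_of_maximalFn_le [OpensMeasurableSpace P]
    (hμ : ∀ (x : P) (r : ℝ), 0 < r → 0 < μ (ball x r) ∧ μ (ball x r) < ⊤)
    {u : P → ℝ≥0∞} {s : ℝ≥0∞} (hs : s ≠ ⊤) {x : P} {r : ℝ} (hr : 0 < r)
    (hx : maximalFn μ 1 u x ≤ s) :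
    ∫⁻ z in closedBall x r, u z ∂μ ≤ s * μ (closedBall x r) := by
  have hlim : Tendsto (μ ∘ ball x) (𝓝[>] r) (𝓝 (μ (closedBall x r))) := by
    have := tendsto_measure_biInter_gt (μ := μ) (s := ball x) (a := r)
      (fun _ _ => measurableSet_ball.nullMeasurableSet) (fun _ _ _ h => ball_subset_ball h)
      ⟨r + 1, by simp, (hμ x _ (by positivity)).2.ne⟩
    rwa [biInter_gt_ball] at this
  refine ge_of_tendsto (ENNReal.Tendsto.const_mul hlim (Or.inr hs)) ?_
  filter_upwards [self_mem_nhdsWithin] with ρ (hρ : r < ρ)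
  have hρ0 : 0 < ρ := hr.trans hρ
  exact (lintegral_mono_set (closedBall_subset_ball hρ)).trans
    (setLIntegral_ball_le_of_maximalFn_le μ hx (mem_ball_self hρ0) (hμ x ρ hρ0).1.ne'
      (hμ x ρ hρ0).2.ne)

end MaximalFunction

section Doubling

variable {P : Type*} [MetricSpace P] [MeasurableSpace P] {μ : Measure P}

theorem measure_ball_sixteen_mul_le {Cd : ℝ≥0}
    (hd : ∀ (x : P) (r : ℝ), 0 < r → μ (ball x (2 * r)) ≤ (Cd : ℝ≥0∞) * μ (ball x r))
    (x : P) {r : ℝ} (hr : 0 < r) : μ (ball x (16 * r)) ≤ (Cd : ℝ≥0∞) ^ 4 * μ (ball x r) := by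
  calc μ (ball x (16 * r)) = μ (ball x (2 * (2 * (2 * (2 * r))))) := by ring_nf
    _ ≤ Cd * (Cd * (Cd * (Cd * μ (ball x r)))) := by
        refine (hd x _ (by positivity)).trans ?_
        gcongr
        refine (hd x _ (by positivity)).trans ?_
        gcongr
        refine (hd x _ (by positivity)).trans ?_
        gcongr
        exact hd x _ hr
    _ = (Cd : ℝ≥0∞) ^ 4 * μ (ball x r) := by ring

theorem isUnifLocDoublingMeasure_of_measure_ball_le {Cd : ℝ≥0}
    (hd : ∀ (x : P) (r : ℝ), 0 < r → μ (ball x (2 * r)) ≤ (Cd : ℝ≥0∞) * μ (ball x r)) :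
    IsUnifLocDoublingMeasure μ := by
  refine ⟨Cd ^ 4, ?_⟩
  filter_upwards [self_mem_nhdsWithin] with ε (hε : 0 < ε) x
  calc μ (closedBall x (2 * ε)) ≤ μ (ball x (16 * ε)) :=
        measure_mono (closedBall_subset_ball (by linarith))
    _ ≤ (Cd : ℝ≥0∞) ^ 4 * μ (ball x ε) := measure_ball_sixteen_mul_le hd x hε
    _ ≤ _ := by
        push_cast
        gcongr
        exact ball_subset_closedBall

variable [BorelSpace P]

theorem countable_of_pairwiseDisjoint_closedBall [SFinite μ]
    (hμ : ∀ (x : P) (r : ℝ), 0 < r → 0 < μ (ball x r) ∧ μ (ball x r) < ⊤)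
    {v : Set P} {r : P → ℝ} (hr : ∀ x ∈ v, 0 < r x)
    (hv : v.PairwiseDisjoint fun x => closedBall x (r x)) : v.Countable := by
  have h := Measure.countable_meas_pos_of_disjoint_iUnion (μ := μ)
    (As := fun x : v => closedBall (x : P) (r x)) (fun _ => measurableSet_closedBall)
    (fun x y hxy => hv x.2 y.2 fun h => hxy (Subtype.ext h))
  have huniv : {x : v | 0 < μ (closedBall (x : P) (r x))} = univ :=
    eq_univ_of_forall fun x =>
      (hμ x _ (hr x x.2)).1.trans_le (measure_mono ball_subset_closedBall)
  rw [huniv] at h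
  exact countable_coe_iff.1 (countable_univ_iff.1 h)

theorem secondCountableTopology_of_measure_ball_pos [SFinite μ]
    (hμ : ∀ (x : P) (r : ℝ), 0 < r → 0 < μ (ball x r) ∧ μ (ball x r) < ⊤) :
    SecondCountableTopology P := by
  refine secondCountable_of_almost_dense_set fun ε hε => ?_
  obtain ⟨v, -, hv, hcov⟩ := Vitali.exists_disjoint_subfamily_covering_enlargement_closedBall
    (univ : Set P) id (fun _ => ε / 4) (ε / 4) (fun _ _ => le_rfl) 4 (by norm_num)
  refine ⟨v, countable_of_pairwiseDisjoint_closedBall hμ (fun _ _ => by positivity) hv,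
    fun x => ?_⟩
  obtain ⟨y, hy, hxy⟩ := hcov x (mem_univ x)
  have := hxy (mem_closedBall_self (by positivity))
  exact ⟨y, hy, by simpa [mul_div_cancel₀] using this⟩

/-- The density theorem for superlevel sets: it needs no integrability of `u`. -/
theorem ae_le_of_maximalFn_le [SFinite μ] {Cd : ℝ≥0}
    (hμ : ∀ (x : P) (r : ℝ), 0 < r → 0 < μ (ball x r) ∧ μ (ball x r) < ⊤)
    (hd : ∀ (x : P) (r : ℝ), 0 < r → μ (ball x (2 * r)) ≤ (Cd : ℝ≥0∞) * μ (ball x r))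
    {u : P → ℝ≥0∞} (hu : Measurable u) {s : ℝ≥0∞} (hs : s ≠ ⊤) :
    ∀ᵐ x ∂μ, maximalFn μ 1 u x ≤ s → u x ≤ s := by
  have := secondCountableTopology_of_measure_ball_pos hμ
  have := isUnifLocDoublingMeasure_of_measure_ball_le hd
  have : IsLocallyFiniteMeasure μ :=
    ⟨fun x => ⟨ball x 1, ball_mem_nhds x one_pos, (hμ x 1 one_pos).2⟩⟩
  have hlevel : ∀ q : ℝ≥0∞, ∀ᵐ x ∂μ, maximalFn μ 1 u x ≤ s → q < u x → q ≤ s := by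
    intro q
    have hS : MeasurableSet {x | q < u x} := measurableSet_lt measurable_const hu
    have hdens := (ae_restrict_iff' hS).1
      (IsUnifLocDoublingMeasure.ae_tendsto_measure_inter_div μ {x | q < u x} 1)
    filter_upwards [hdens] with x hx hMx hqx
    have hlim := hx hqx (ι := ℝ) (l := 𝓝[>] 0) (fun _ => x) id tendsto_id
      (by filter_upwards [self_mem_nhdsWithin] with δ (hδ : 0 < δ) using by simpa using hδ.le)
    have hlim' := ENNReal.Tendsto.const_mul (a := q) hlim (Or.inl one_ne_zero)
    rw [mul_one] at hlim'
    refine le_of_tendsto hlim' ?_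
    filter_upwards [self_mem_nhdsWithin] with δ (hδ : 0 < δ)
    rw [id, ← mul_div_assoc]
    refine ENNReal.div_le_of_le_mul ?_
    calc q * μ ({x | q < u x} ∩ closedBall x δ)
        = ∫⁻ _ in {x | q < u x} ∩ closedBall x δ, q ∂μ := (setLIntegral_const _ _).symm
      _ ≤ ∫⁻ z in {x | q < u x} ∩ closedBall x δ, u z ∂μ :=
          setLIntegral_mono hu fun z hz => (show q < u z from hz.1).le
      _ ≤ ∫⁻ z in closedBall x δ, u z ∂μ := lintegral_mono_set inter_subset_right
      _ ≤ s * μ (closedBall x δ) :=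
          setLIntegral_closedBall_le_of_maximalFn_le μ hμ hs hδ hMx
  have hall : ∀ᵐ x ∂μ, ∀ q : ℚ, maximalFn μ 1 u x ≤ s →
      ENNReal.ofReal q < u x → ENNReal.ofReal q ≤ s := ae_all_iff.2 fun q => hlevel _
  filter_upwards [hall] with x hx hMx
  by_contra! h
  obtain ⟨q, -, hsq, hqu⟩ := ENNReal.lt_iff_exists_rat_btwn.1 h
  exact absurd (hx q hMx hqu) (not_le.2 hsq)

theorem setLIntegral_le_of_forall_notMem_maximalFn_le [SFinite μ] {Cd : ℝ≥0}
    (hμ : ∀ (x : P) (r : ℝ), 0 < r → 0 < μ (ball x r) ∧ μ (ball x r) < ⊤)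
    (hd : ∀ (x : P) (r : ℝ), 0 < r → μ (ball x (2 * r)) ≤ (Cd : ℝ≥0∞) * μ (ball x r))
    {u : P → ℝ≥0∞} {s : ℝ≥0∞} {E : Set P} (hE : IsOpen E) (hEc : Eᶜ.Nonempty)
    (hM : ∀ x ∈ Eᶜ, maximalFn μ 1 u x ≤ s) :
    ∫⁻ x in E, u x ∂μ ≤ (Cd : ℝ≥0∞) ^ 4 * s * μ E := by
  have hpos : ∀ x ∈ E, 0 < infDist x Eᶜ := fun x hx =>
    (hE.isClosed_compl.notMem_iff_infDist_pos hEc).1 (by simpa using hx)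
  have hbdd : ∀ n : ℕ, ∫⁻ x in E ∩ {x | infDist x Eᶜ ≤ n}, u x ∂μ ≤
      (Cd : ℝ≥0∞) ^ 4 * s * μ E := by
    intro n
    obtain ⟨v, hvE, hv, hcov⟩ :=
      Vitali.exists_disjoint_subfamily_covering_enlargement_closedBall
        (E ∩ {x | infDist x Eᶜ ≤ n}) id (fun x => infDist x Eᶜ / 8) (n / 8)
        (fun x hx => by have : infDist x Eᶜ ≤ n := hx.2; linarith) 4 (by norm_num)
    have hvpos : ∀ x ∈ v, 0 < infDist x Eᶜ / 8 := fun x hx => by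
      have := hpos x (hvE hx).1; positivity
    have hvc : v.Countable := countable_of_pairwiseDisjoint_closedBall hμ hvpos hv
    have hball : ∀ x ∈ v, ∫⁻ z in ball x (16 * (infDist x Eᶜ / 8)), u z ∂μ ≤
        (Cd : ℝ≥0∞) ^ 4 * s * μ (closedBall x (infDist x Eᶜ / 8)) := by
      intro x hx
      have hx0 := hvpos x hx
      obtain ⟨y, hy, hxy⟩ := (infDist_lt_iff (x := x) (r := 16 * (infDist x Eᶜ / 8)) hEc).1
        (by linarith)
      have h16 := hμ x (16 * (infDist x Eᶜ / 8)) (by positivity)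
      calc ∫⁻ z in ball x (16 * (infDist x Eᶜ / 8)), u z ∂μ
          ≤ s * μ (ball x (16 * (infDist x Eᶜ / 8))) :=
            setLIntegral_ball_le_of_maximalFn_le μ (hM y hy) (mem_ball'.2 hxy) h16.1.ne' h16.2.ne
        _ ≤ s * ((Cd : ℝ≥0∞) ^ 4 * μ (closedBall x (infDist x Eᶜ / 8))) := by
            gcongr
            refine (measure_ball_sixteen_mul_le hd x hx0).trans ?_
            gcongr
            exact ball_subset_closedBall
        _ = _ := by ring
    have hsub : E ∩ {x | infDist x Eᶜ ≤ n} ⊆ ⋃ x ∈ v, ball x (16 * (infDist x Eᶜ / 8)) := by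
      intro x hx
      obtain ⟨y, hy, hxy⟩ := hcov x hx
      have hy0 := hvpos y hy
      have hx0 := hpos x hx.1
      exact mem_iUnion₂.2 ⟨y, hy, closedBall_subset_ball (by linarith)
        (hxy (mem_closedBall_self (by positivity)))⟩
    have : Countable v := hvc.to_subtype
    calc ∫⁻ x in E ∩ {x | infDist x Eᶜ ≤ n}, u x ∂μ
        ≤ ∫⁻ x in ⋃ x : v, ball (x : P) (16 * (infDist (x : P) Eᶜ / 8)), u x ∂μ := by
          rw [biUnion_eq_iUnion] at hsub
          exact lintegral_mono_set hsub
      _ ≤ ∑' x : v, ∫⁻ z in ball (x : P) (16 * (infDist (x : P) Eᶜ / 8)), u z ∂μ :=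
          lintegral_iUnion_le _ _
      _ ≤ ∑' x : v, (Cd : ℝ≥0∞) ^ 4 * s * μ (closedBall (x : P) (infDist (x : P) Eᶜ / 8)) :=
          ENNReal.tsum_le_tsum fun x => hball x x.2
      _ = (Cd : ℝ≥0∞) ^ 4 * s * μ (⋃ x ∈ v, closedBall x (infDist x Eᶜ / 8)) := by
          rw [ENNReal.tsum_mul_left]
          congr 1
          exact (measure_biUnion hvc hv fun _ _ => measurableSet_closedBall).symm
      _ ≤ (Cd : ℝ≥0∞) ^ 4 * s * μ E := by
          gcongr
          refine iUnion₂_subset fun x hx => ?_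
          have hx0 := hvpos x hx
          exact (closedBall_subset_ball (by linarith)).trans ball_infDist_compl_subset
  have hunion : E = ⋃ n : ℕ, E ∩ {x | infDist x Eᶜ ≤ n} := by
    rw [← inter_iUnion]
    refine (inter_eq_left.2 fun x _ => ?_).symm
    exact mem_iUnion.2 (exists_nat_ge (infDist x Eᶜ))
  have hmono : Monotone fun n : ℕ => E ∩ {x | infDist x Eᶜ ≤ n} := fun m n hmn x hx =>
    ⟨hx.1, le_trans (show infDist x Eᶜ ≤ m from hx.2) (by exact_mod_cast hmn)⟩
  conv_lhs => rw [hunion]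
  rw [setLIntegral_iUnion_of_directed _ hmono.directed_le]
  exact iSup_le hbdd

end Doubling

/-- **Herz's half of the Herz–Riesz inequality:** on any metric measure space with a
σ-finite Borel regular doubling measure giving balls finite positive measure, there is a
constant `C > 0` depending only on the doubling constant such that
`u**(t) ≤ C · (M₁ u)*(t)` for all measurable `u` and all `t ∈ (0, μ(P))`. -/
theorem doubleStar_le_rearrangement_maximal (Cd : ℝ≥0) (hCd : 1 ≤ Cd) :
    ∃ C : ℝ, 0 < C ∧
      ∀ (P : Type) [MetricSpace P] [MeasurableSpace P] [BorelSpace P]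
        (μ : Measure P), SigmaFinite μ →
        (∀ (x : P) (r : ℝ), 0 < r →
          0 < μ (Metric.ball x r) ∧ μ (Metric.ball x r) < ⊤) →
        (∀ (x : P) (r : ℝ), 0 < r →
          μ (Metric.ball x (2 * r)) ≤ (Cd : ℝ≥0∞) * μ (Metric.ball x r)) →
        ∀ u : P → ℝ≥0∞, Measurable u →
          ∀ t : ℝ, 0 < t → ENNReal.ofReal t < μ Set.univ →
            doubleStar μ u t ≤ ENNReal.ofReal C * rearr μ (maximalFn μ 1 u) t := by
  refine ⟨1 + (Cd : ℝ) ^ 4, by positivity, ?_⟩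
  intro P _ _ _ μ _ hμ hd u hu t ht htμ
  have hC : ENNReal.ofReal (1 + (Cd : ℝ) ^ 4) = 1 + (Cd : ℝ≥0∞) ^ 4 := by
    rw [ENNReal.ofReal_add zero_le_one (by positivity), ENNReal.ofReal_pow Cd.coe_nonneg]
    simp
  have hC0 : (1 + (Cd : ℝ≥0∞) ^ 4) ≠ 0 := by simp
  have hCtop : (1 + (Cd : ℝ≥0∞) ^ 4) ≠ ⊤ := by finiteness
  rw [hC]
  refine (ENNReal.div_le_iff' hC0 hCtop).1 (le_sInf fun s hs => ?_)
  rw [ENNReal.div_le_iff' hC0 hCtop]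
  rcases eq_or_ne s ⊤ with rfl | hs_top
  · simp [ENNReal.mul_top hC0]
  have hs' : μ {x | s < maximalFn μ 1 u x} ≤ ENNReal.ofReal t := hs
  have hE := isOpen_lt_maximalFn μ 1 u s
  have hEc : {x | s < maximalFn μ 1 u x}ᶜ.Nonempty := by
    rw [nonempty_compl]
    intro h
    rw [h] at hs'
    exact absurd hs' (not_le.2 htμ)
  rw [add_mul, one_mul]
  refine doubleStar_le_of_ae_le_add μ (hu.indicator hE.measurableSet) ?_ ht ?_
  · filter_upwards [ae_le_of_maximalFn_le hμ hd hu hs_top] with x hx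
    by_cases hxE : s < maximalFn μ 1 u x
    · rw [indicator_of_mem (show x ∈ {x | s < maximalFn μ 1 u x} from hxE)]
      exact le_add_self
    · exact (hx (not_lt.1 hxE)).trans le_self_add
  · rw [lintegral_indicator hE.measurableSet]
    refine (setLIntegral_le_of_forall_notMem_maximalFn_le hμ hd hE hEc
      fun x hx => not_lt.1 hx).trans ?_
    gcongr
end

section
/- Let (P, d, μ) be a metric measure space where μ is a σ-finite Borel regular measure such that every open ball has finite positive measure, and μ is doubling. Let p ∈ [1,∞) and let φ be quasi-concave. Then there is a constant C > 0, depending only on the doubling constant and p, such that for every μ-measurable u: sup_{t>0} (M_p u)*(t)·φ(t) ≤ C · sup_{t>0} A_p u*(t)·φ(t). (This expresses the boundedness of M_p from the Marcinkiewicz-type space M^p_φ to the weak Marcinkiewicz space M^*_φ.) -/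
open MeasureTheory
open scoped ENNReal NNReal

/-- The maximal average `A_p f (t) = ((1/t) ∫₀^t f(s)^p ds)^{1/p}`. -/
noncomputable def Ap (p : ℝ) (f : ℝ → ℝ≥0∞) (t : ℝ) : ℝ≥0∞ :=
  ((ENNReal.ofReal t)⁻¹ * ∫⁻ s in Set.Ioo (0 : ℝ) t, f s ^ p) ^ (1 / p)

/-- A function `φ : [0,∞) → [0,∞)` is quasi-concave. -/
def QuasiConcave (φ : ℝ → ℝ) : Prop :=
  φ 0 = 0 ∧ (∀ t : ℝ, 0 < t → 0 < φ t) ∧ MonotoneOn φ (Set.Ici 0) ∧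
    AntitoneOn (fun t => φ t / t) (Set.Ioi 0)

/-- Layer cake formula for functions with values in `[0,∞]`. -/
theorem lintegral_eq_lintegral_meas_ofReal_lt {α : Type*} [MeasurableSpace α] (ν : Measure α)
    [SFinite ν] {f : α → ℝ≥0∞} (hf : Measurable f) :
    ∫⁻ x, f x ∂ν = ∫⁻ r in Set.Ioi (0 : ℝ), ν {x | ENNReal.ofReal r < f x} := by
  have hS : MeasurableSet {q : α × ℝ | ENNReal.ofReal q.2 < f q.1} :=
    measurableSet_lt (ENNReal.measurable_ofReal.comp measurable_snd) (hf.comp measurable_fst)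
  have hslice : ∀ a : ℝ≥0∞,
      volume.restrict (Set.Ioi (0 : ℝ)) {r : ℝ | ENNReal.ofReal r < a} = a := by
    intro a
    rw [Measure.restrict_apply (measurableSet_lt ENNReal.measurable_ofReal measurable_const)]
    induction a with
    | top => simp
    | coe a =>
      have : {r : ℝ | ENNReal.ofReal r < a} ∩ Set.Ioi 0 = Set.Ioo 0 (a : ℝ) := by
        ext r
        simp only [Set.mem_inter_iff, Set.mem_ofPred_eq, Set.mem_Ioi, Set.mem_Ioo]
        rw [and_comm]
        refine and_congr_right fun hr => ?_
        rw [ENNReal.ofReal_lt_iff_lt_toReal hr.le ENNReal.coe_ne_top, ENNReal.coe_toReal]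
      rw [this, Real.volume_Ioo, sub_zero, ENNReal.ofReal_coe_nnreal]
  have h₁ := Measure.prod_apply (μ := ν) (ν := volume.restrict (Set.Ioi (0 : ℝ))) hS
  rw [Measure.prod_apply_symm hS] at h₁
  refine Eq.trans ?_ h₁.symm
  exact lintegral_congr fun x => (hslice (f x)).symm

/-- Domination of distribution functions implies domination of integrals. -/
theorem lintegral_le_lintegral_of_meas_lt_le {α β : Type*} [MeasurableSpace α]
    [MeasurableSpace β] {μ : Measure α} {ν : Measure β} [SFinite μ] [SFinite ν]
    {f : α → ℝ≥0∞} {g : β → ℝ≥0∞} (hf : Measurable f) (hg : Measurable g)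
    (h : ∀ s, μ {x | s < f x} ≤ ν {y | s < g y}) :
    ∫⁻ x, f x ∂μ ≤ ∫⁻ y, g y ∂ν := by
  rw [lintegral_eq_lintegral_meas_ofReal_lt μ hf, lintegral_eq_lintegral_meas_ofReal_lt ν hg]
  exact lintegral_mono fun r => h _

theorem antitone_rearr {P : Type*} [MeasurableSpace P] (μ : Measure P) (u : P → ℝ≥0∞) :
    Antitone (rearr μ u) := fun _ _ hst =>
  sInf_le_sInf fun _ hs => le_trans hs (ENNReal.ofReal_le_ofReal hst)

/-- The infimum defining the decreasing rearrangement is attained. -/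
theorem meas_rearr_lt_le {P : Type*} [MeasurableSpace P] (μ : Measure P) (u : P → ℝ≥0∞)
    (t : ℝ) : μ {x | rearr μ u t < u x} ≤ ENNReal.ofReal t := by
  obtain ⟨v, hv, hlim, hmem⟩ := exists_seq_tendsto_sInf
    (S := {s : ℝ≥0∞ | μ {x | s < u x} ≤ ENNReal.ofReal t}) ⟨⊤, by simp⟩ (OrderBot.bddBelow _)
  have hU : {x | rearr μ u t < u x} = ⋃ n, {x | v n < u x} := by
    ext x
    simp only [Set.mem_ofPred_eq, Set.mem_iUnion]
    refine ⟨fun hx => (hlim.eventually_lt_const hx).exists, fun ⟨n, hn⟩ => ?_⟩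
    exact lt_of_le_of_lt (sInf_le (hmem n)) hn
  have hmono : Monotone fun n => {x | v n < u x} := fun m n hmn x hx =>
    lt_of_le_of_lt (hv hmn) hx
  rw [hU, hmono.measure_iUnion]
  exact iSup_le hmem

/-- The integral of `u ^ p` over a set of measure at most `t` is bounded by the integral of
`(u*) ^ p` over `(0, t)`. -/
theorem setLIntegral_rpow_le_lintegral_rearr {P : Type*} [MeasurableSpace P] (μ : Measure P)
    [SFinite μ] {u : P → ℝ≥0∞} (hu : Measurable u) {p : ℝ} (hp : 0 < p) {t : ℝ}
    {E : Set P} (hE : μ E ≤ ENNReal.ofReal t) :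
    ∫⁻ x in E, u x ^ p ∂μ ≤ ∫⁻ s in Set.Ioo (0 : ℝ) t, rearr μ u s ^ p := by
  have hr : Measurable (rearr μ u) := (antitone_rearr μ u).measurable
  refine lintegral_le_lintegral_of_meas_lt_le (hu.pow_const p) (hr.pow_const p) fun s => ?_
  simp only [← ENNReal.rpow_inv_lt_iff hp]
  rw [Measure.restrict_apply (measurableSet_lt measurable_const hu),
    Measure.restrict_apply (measurableSet_lt measurable_const hr)]
  set σ := s ^ p⁻¹
  have key : ∀ r : ℝ, ENNReal.ofReal r < μ {x | σ < u x} → σ < rearr μ u r := by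
    intro r hlt
    by_contra! hle
    refine absurd (meas_rearr_lt_le μ u r) (not_le.2 (hlt.trans_le ?_))
    exact measure_mono fun x (hx : σ < u x) => lt_of_le_of_lt hle hx
  by_cases hm : ENNReal.ofReal t ≤ μ {x | σ < u x}
  · calc μ ({x | σ < u x} ∩ E) ≤ ENNReal.ofReal t :=
          (measure_mono Set.inter_subset_right).trans hE
      _ = volume (Set.Ioo (0 : ℝ) t) := by rw [Real.volume_Ioo, sub_zero]
      _ ≤ _ := measure_mono fun r hr => by
        exact ⟨key r (lt_of_lt_of_le
          ((ENNReal.ofReal_lt_ofReal_iff (hr.1.trans hr.2)).2 hr.2) hm), hr⟩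
  · have hm' := (not_le.1 hm)
    have hfin := (hm'.trans ENNReal.ofReal_lt_top).ne
    calc μ ({x | σ < u x} ∩ E) ≤ μ {x | σ < u x} := measure_mono Set.inter_subset_left
      _ = volume (Set.Ioo (0 : ℝ) (μ {x | σ < u x}).toReal) := by
        rw [Real.volume_Ioo, sub_zero, ENNReal.ofReal_toReal hfin]
      _ ≤ _ := measure_mono fun r hr => by
        have hlt := (ENNReal.ofReal_lt_iff_lt_toReal hr.1.le hfin).2 hr.2
        exact ⟨key r hlt, hr.1, (ENNReal.ofReal_lt_ofReal_iff'.1 (hlt.trans hm')).1⟩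

/-- The weak-type `(1,1)` covering estimate for the balls of bounded radius on which `g` has large
average. -/
theorem meas_iUnion_ball_large_average_le {P : Type*} [PseudoMetricSpace P] [MeasurableSpace P]
    [OpensMeasurableSpace P] (μ : Measure P) [SFinite μ] {D : ℝ≥0∞}
    (hpos : ∀ (x : P) (r : ℝ), 0 < r → 0 < μ (Metric.ball x r))
    (hD : ∀ (x : P) (r : ℝ), 0 < r → μ (Metric.ball x (8 * r)) ≤ D * μ (Metric.ball x r))
    (g : P → ℝ≥0∞) (a : ℝ≥0∞) (R : ℝ) :
    a * μ {x | ∃ (c : P) (r : ℝ), 0 < r ∧ r ≤ R ∧ x ∈ Metric.ball c r ∧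
      a * μ (Metric.ball c r) ≤ ∫⁻ z in Metric.ball c r, g z ∂μ} ≤ D * ∫⁻ z, g z ∂μ := by
  set T : Set (P × ℝ) := {q | 0 < q.2 ∧ q.2 ≤ R ∧
    a * μ (Metric.ball q.1 q.2) ≤ ∫⁻ z in Metric.ball q.1 q.2, g z ∂μ}
  obtain ⟨w, hwT, hdisj, hcov⟩ := Vitali.exists_disjoint_subfamily_covering_enlargement_closedBall
    T Prod.fst Prod.snd R (fun q hq => hq.2.1) 4 (by norm_num)
  have hdisj' : w.PairwiseDisjoint fun q => Metric.ball q.1 q.2 :=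
    hdisj.mono fun q => Metric.ball_subset_closedBall
  have hcount : w.Countable := by
    have h := Measure.countable_meas_pos_of_disjoint_iUnion (μ := μ)
      (As := fun q : w => Metric.ball q.1.1 q.1.2) (fun q => Metric.isOpen_ball.measurableSet)
      (fun q q' hqq' => hdisj' q.2 q'.2 (fun h => hqq' (Subtype.ext h)))
    have hall : {q : w | 0 < μ (Metric.ball q.1.1 q.1.2)} = Set.univ :=
      Set.eq_univ_of_forall fun q => hpos _ _ (hwT q.2).1
    rw [hall, Set.countable_univ_iff] at h
    exact h
  have hsub : {x | ∃ (c : P) (r : ℝ), 0 < r ∧ r ≤ R ∧ x ∈ Metric.ball c r ∧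
      a * μ (Metric.ball c r) ≤ ∫⁻ z in Metric.ball c r, g z ∂μ} ⊆
      ⋃ q ∈ w, Metric.ball q.1 (8 * q.2) := by
    rintro x ⟨c, r, hr, hrR, hx, hg⟩
    obtain ⟨q, hq, hsubq⟩ := hcov (c, r) ⟨hr, hrR, hg⟩
    refine Set.mem_biUnion hq (Metric.closedBall_subset_ball ?_
      (hsubq (Metric.ball_subset_closedBall hx)))
    linarith [(hwT hq).1]
  have := hcount.to_subtype
  calc a * μ _ ≤ a * ∑' q : w, μ (Metric.ball q.1.1 (8 * q.1.2)) := by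
        gcongr
        exact (measure_mono hsub).trans (measure_biUnion_le μ hcount _)
    _ ≤ a * ∑' q : w, D * μ (Metric.ball q.1.1 q.1.2) := by
        gcongr with q
        exact hD _ _ (hwT q.2).1
    _ = D * ∑' q : w, a * μ (Metric.ball q.1.1 q.1.2) := by
        rw [ENNReal.tsum_mul_left, ENNReal.tsum_mul_left, mul_left_comm]
    _ ≤ D * ∑' q : w, ∫⁻ z in Metric.ball q.1.1 q.1.2, g z ∂μ := by
        gcongr with q
        exact (hwT q.2).2.2
    _ = D * ∫⁻ z in ⋃ q ∈ w, Metric.ball q.1 q.2, g z ∂μ := by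
        rw [lintegral_biUnion hcount (fun q _ => Metric.isOpen_ball.measurableSet) hdisj']
    _ ≤ D * ∫⁻ z, g z ∂μ := by
        gcongr
        exact Measure.restrict_le_self

/-- The weak-type `(1,1)` estimate for the non-centered maximal function on a doubling space. -/
theorem meas_large_average_le {P : Type*} [PseudoMetricSpace P] [MeasurableSpace P]
    [OpensMeasurableSpace P] (μ : Measure P) [SFinite μ] {D : ℝ≥0∞}
    (hpos : ∀ (x : P) (r : ℝ), 0 < r → 0 < μ (Metric.ball x r))
    (hD : ∀ (x : P) (r : ℝ), 0 < r → μ (Metric.ball x (8 * r)) ≤ D * μ (Metric.ball x r))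
    (g : P → ℝ≥0∞) (a : ℝ≥0∞) :
    a * μ {x | ∃ (c : P) (r : ℝ), 0 < r ∧ x ∈ Metric.ball c r ∧
      a * μ (Metric.ball c r) ≤ ∫⁻ z in Metric.ball c r, g z ∂μ} ≤ D * ∫⁻ z, g z ∂μ := by
  have hU : {x | ∃ (c : P) (r : ℝ), 0 < r ∧ x ∈ Metric.ball c r ∧
      a * μ (Metric.ball c r) ≤ ∫⁻ z in Metric.ball c r, g z ∂μ} =
      ⋃ n : ℕ, {x | ∃ (c : P) (r : ℝ), 0 < r ∧ r ≤ n ∧ x ∈ Metric.ball c r ∧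
        a * μ (Metric.ball c r) ≤ ∫⁻ z in Metric.ball c r, g z ∂μ} := by
    ext x
    simp only [Set.mem_ofPred_eq, Set.mem_iUnion]
    constructor
    · rintro ⟨c, r, hr, h⟩
      obtain ⟨n, hn⟩ := exists_nat_ge r
      exact ⟨n, c, r, hr, hn, h⟩
    · rintro ⟨n, c, r, hr, -, h⟩
      exact ⟨c, r, hr, h⟩
  rw [hU, Monotone.measure_iUnion, ENNReal.mul_iSup]
  · exact iSup_le fun n => meas_iUnion_ball_large_average_le μ hpos hD g a n
  · rintro m n hmn x ⟨c, r, hr, hrm, h⟩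
    exact ⟨c, r, hr, hrm.trans (Nat.cast_le.2 hmn), h⟩

/-- Pointwise form of the boundedness of the maximal operator:
`(M_p u)*(t) ≤ (1 + D) ^ (1 / p) A_p u*(t)`. -/
theorem rearr_maximalFn_le {P : Type*} [PseudoMetricSpace P] [MeasurableSpace P]
    [OpensMeasurableSpace P] (μ : Measure P) [SFinite μ] {D : ℝ≥0∞} (hD₀ : D ≠ 0) (hD₁ : D ≠ ⊤)
    (hball : ∀ (x : P) (r : ℝ), 0 < r → 0 < μ (Metric.ball x r) ∧ μ (Metric.ball x r) < ⊤)
    (hD : ∀ (x : P) (r : ℝ), 0 < r → μ (Metric.ball x (8 * r)) ≤ D * μ (Metric.ball x r))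
    {p : ℝ} (hp : 0 < p) {u : P → ℝ≥0∞} (hu : Measurable u) {t : ℝ} (ht : 0 < t) :
    rearr μ (maximalFn μ p u) t ≤ (1 + D) ^ (1 / p) * Ap p (rearr μ u) t := by
  have hp' : 0 < 1 / p := one_div_pos.2 hp
  have ht₀ : ENNReal.ofReal t ≠ 0 := (ENNReal.ofReal_pos.2 ht).ne'
  have ht₁ : ENNReal.ofReal t ≠ ⊤ := ENNReal.ofReal_ne_top
  set I := ∫⁻ s in Set.Ioo (0 : ℝ) t, rearr μ u s ^ p with hI
  set F := (ENNReal.ofReal t)⁻¹ * I with hF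
  have hAp : Ap p (rearr μ u) t = F ^ (1 / p) := rfl
  have hIF : I = ENNReal.ofReal t * F := by
    rw [hF, ← mul_assoc, ENNReal.mul_inv_cancel ht₀ ht₁, one_mul]
  rw [hAp, ← ENNReal.mul_rpow_of_nonneg _ _ hp'.le]
  rcases eq_or_ne F ⊤ with hFtop | hFtop
  · rw [hFtop, ENNReal.mul_top (by simp), ENNReal.top_rpow_of_pos hp']
    exact le_top
  set b := rearr μ u t
  have hbF : b ^ p ≤ F := by
    have : b ^ p * ENNReal.ofReal t ≤ I := by
      calc b ^ p * ENNReal.ofReal t = ∫⁻ s in Set.Ioo (0 : ℝ) t, b ^ p := by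
            rw [setLIntegral_const, Real.volume_Ioo, sub_zero]
        _ ≤ I := setLIntegral_mono' measurableSet_Ioo fun s hs => by
            gcongr
            exact antitone_rearr μ u hs.2.le
    rw [hIF, mul_comm] at this
    exact (ENNReal.mul_le_mul_iff_right ht₀ ht₁).1 this
  set E := {x | b < u x}
  have hEmeas : MeasurableSet E := measurableSet_lt measurable_const hu
  set g := E.indicator fun x => u x ^ p
  have hgI : ∫⁻ x, g x ∂μ ≤ I := by
    rw [lintegral_indicator hEmeas]
    exact setLIntegral_rpow_le_lintegral_rearr μ hu hp (meas_rearr_lt_le μ u t)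
  have hug : ∀ x, u x ^ p ≤ b ^ p + g x := by
    intro x
    by_cases hx : x ∈ E
    · simp only [g, Set.indicator_of_mem hx]
      exact le_add_self
    · exact le_add_right (ENNReal.rpow_le_rpow (not_lt.1 hx) hp.le)
  have hsub : ∀ x, ((1 + D) * F) ^ (1 / p) < maximalFn μ p u x →
      ∃ (c : P) (r : ℝ), 0 < r ∧ x ∈ Metric.ball c r ∧
        D * F * μ (Metric.ball c r) < ∫⁻ z in Metric.ball c r, g z ∂μ := by
    intro x hx
    simp only [maximalFn, lt_iSup_iff] at hx
    obtain ⟨c, r, hr, hxr, hlt⟩ := hx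
    refine ⟨c, r, hr, hxr, ?_⟩
    have hm₀ := (hball c r hr).1.ne'
    have hm₁ := (hball c r hr).2.ne
    set m := μ (Metric.ball c r)
    rw [ENNReal.rpow_lt_rpow_iff hp', mul_comm m⁻¹, ← div_eq_mul_inv,
      ENNReal.lt_div_iff_mul_lt (Or.inl hm₀) (Or.inl hm₁)] at hlt
    have hle : ∫⁻ z in Metric.ball c r, u z ^ p ∂μ ≤
        F * m + ∫⁻ z in Metric.ball c r, g z ∂μ := by
      calc ∫⁻ z in Metric.ball c r, u z ^ p ∂μ
          ≤ ∫⁻ z in Metric.ball c r, (b ^ p + g z) ∂μ := lintegral_mono hug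
        _ = b ^ p * m + ∫⁻ z in Metric.ball c r, g z ∂μ := by
          rw [lintegral_add_left measurable_const, setLIntegral_const]
        _ ≤ _ := by gcongr
    have h := hlt.trans_le hle
    rw [add_mul, one_mul, add_mul] at h
    exact lt_of_add_lt_add_left h
  refine sInf_le ?_
  rcases eq_or_ne F 0 with hF₀ | hF₀
  · have hg₀ : ∫⁻ x, g x ∂μ = 0 := by
      rw [hIF, hF₀, mul_zero] at hgI
      exact nonpos_iff_eq_zero.1 hgI
    have hempty : {x | ((1 + D) * F) ^ (1 / p) < maximalFn μ p u x} = ∅ := by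
      refine Set.eq_empty_of_forall_notMem fun x hx => ?_
      obtain ⟨c, r, -, -, hlt⟩ := hsub x hx
      exact not_lt_bot (hlt.trans_le ((setLIntegral_le_lintegral _ _).trans hg₀.le))
    rw [Set.mem_ofPred_eq, hempty, measure_empty]
    exact zero_le
  · have hweak := meas_large_average_le μ (fun x r hr => (hball x r hr).1) hD g (D * F)
    have hmono := measure_mono (μ := μ) (show {x | ((1 + D) * F) ^ (1 / p) < maximalFn μ p u x} ⊆
        {x | ∃ (c : P) (r : ℝ), 0 < r ∧ x ∈ Metric.ball c r ∧
          D * F * μ (Metric.ball c r) ≤ ∫⁻ z in Metric.ball c r, g z ∂μ} from fun x hx => by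
      obtain ⟨c, r, hr, hxr, hlt⟩ := hsub x hx
      exact ⟨c, r, hr, hxr, hlt.le⟩)
    refine hmono.trans ((ENNReal.mul_le_mul_iff_right (mul_ne_zero hD₀ hF₀)
      (ENNReal.mul_ne_top hD₁ hFtop)).1 (hweak.trans ?_))
    rw [mul_assoc, mul_comm F, ← hIF]
    gcongr

/-- **Boundedness of `M_p` from `M^p_φ` to `M^*_φ`:** on any metric measure space with a
σ-finite Borel regular doubling measure giving balls finite positive measure, for any
`p ∈ [1,∞)` and quasi-concave `φ`, there is `C > 0` depending only on the doubling
constant and `p` such that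
`sup_{t>0} (M_p u)*(t) φ(t) ≤ C · sup_{t>0} A_p u*(t) φ(t)` for all measurable `u`. -/
theorem maximal_bounded_Mp_to_weakMarcinkiewicz (Cd : ℝ≥0) (hCd : 1 ≤ Cd)
    (p : ℝ) (hp : 1 ≤ p) :
    ∃ C : ℝ, 0 < C ∧
      ∀ (P : Type) [MetricSpace P] [MeasurableSpace P] [BorelSpace P]
        (μ : Measure P), SigmaFinite μ →
        (∀ (x : P) (r : ℝ), 0 < r →
          0 < μ (Metric.ball x r) ∧ μ (Metric.ball x r) < ⊤) →
        (∀ (x : P) (r : ℝ), 0 < r →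
          μ (Metric.ball x (2 * r)) ≤ (Cd : ℝ≥0∞) * μ (Metric.ball x r)) →
        ∀ φ : ℝ → ℝ, QuasiConcave φ →
        ∀ u : P → ℝ≥0∞, Measurable u →
          (⨆ t ∈ Set.Ioi (0 : ℝ),
              rearr μ (maximalFn μ p u) t * ENNReal.ofReal (φ t)) ≤
            ENNReal.ofReal C *
              ⨆ t ∈ Set.Ioi (0 : ℝ), Ap p (rearr μ u) t * ENNReal.ofReal (φ t) := by
  have hCd₀ : (0 : ℝ≥0) < Cd := lt_of_lt_of_le one_pos hCd
  have hp₀ : 0 < p := lt_of_lt_of_le one_pos hp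
  refine ⟨(1 + (Cd : ℝ) ^ 3) ^ (1 / p), by positivity, ?_⟩
  intro P _ _ _ μ hσ hball hdoub φ _ u hu
  have hD : ∀ (x : P) (r : ℝ), 0 < r →
      μ (Metric.ball x (8 * r)) ≤ (Cd : ℝ≥0∞) ^ 3 * μ (Metric.ball x r) := by
    intro x r hr
    calc μ (Metric.ball x (8 * r)) = μ (Metric.ball x (2 * (2 * (2 * r)))) := by
          congr 2; ring
      _ ≤ Cd * (Cd * (Cd * μ (Metric.ball x r))) := by
          refine (hdoub x _ (by positivity)).trans ?_
          gcongr
          refine (hdoub x _ (by positivity)).trans ?_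
          gcongr
          exact hdoub x r hr
      _ = _ := by ring
  have hC : ENNReal.ofReal ((1 + (Cd : ℝ) ^ 3) ^ (1 / p)) =
      (1 + (Cd : ℝ≥0∞) ^ 3) ^ (1 / p) := by
    rw [← ENNReal.ofReal_rpow_of_pos (by positivity),
      ENNReal.ofReal_add zero_le_one (by positivity), ENNReal.ofReal_one,
      ENNReal.ofReal_pow Cd.coe_nonneg, ENNReal.ofReal_coe_nnreal]
  rw [hC]
  refine iSup₂_le fun t ht => ?_
  have hpt := rearr_maximalFn_le μ (pow_ne_zero 3 (ENNReal.coe_ne_zero.2 hCd₀.ne'))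
    (ENNReal.pow_ne_top ENNReal.coe_ne_top) hball hD hp₀ hu ht
  calc rearr μ (maximalFn μ p u) t * ENNReal.ofReal (φ t)
      ≤ (1 + (Cd : ℝ≥0∞) ^ 3) ^ (1 / p) * Ap p (rearr μ u) t * ENNReal.ofReal (φ t) := by
        gcongr
    _ = (1 + (Cd : ℝ≥0∞) ^ 3) ^ (1 / p) * (Ap p (rearr μ u) t * ENNReal.ofReal (φ t)) :=
        mul_assoc _ _ _
    _ ≤ _ := by
        gcongr
        exact le_iSup₂ (f := fun t (_ : t ∈ Set.Ioi (0 : ℝ)) =>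
          Ap p (rearr μ u) t * ENNReal.ofReal (φ t)) t ht
end
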